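/- Fix δ > 0 and η ∈ (0,1). There exist an integer k₀ and a constant C > 0 such that for every k ≥ k₀ and every y in the exterior region EX = {y ∈ ℝ^N : |y − ξ_j| > η/k for all j = 1,…,k}, one has Σ_{j=1}^k U_j(y) ≤ C U(y). -/

import Mathlib

open MeasureTheory Real Finset ENNReal

noncomputable section

/-- The standard bubble `U(y) = c (1/(1+|y|²))^{(N-2s)/2}`. -/
def bubble (N : ℕ) (s c : ℝ) (y : EuclideanSpace ℝ (Fin N)) : ℝ :=
  c * (1 / (1 + ‖y‖ ^ 2)) ^ (((N : ℝ) - 2 * s) / 2)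

/-- Rescaled, translated bubble `w_{μ,ξ}(y) = μ^{-(N-2s)/2} U((y-ξ)/μ)`. -/
def wBubble (N : ℕ) (s c μ : ℝ) (ξ y : EuclideanSpace ℝ (Fin N)) : ℝ :=
  μ ^ (-(((N : ℝ) - 2 * s) / 2)) * bubble N s c (μ⁻¹ • (y - ξ))

/-- The critical exponent `p = (N+2s)/(N-2s)`. -/
def pExp (N : ℕ) (s : ℝ) : ℝ := ((N : ℝ) + 2 * s) / ((N : ℝ) - 2 * s)

/-- The concentration parameter `μ = δ^{2/(N-2s)} k^{-3}`. -/
def muK (N : ℕ) (s δ : ℝ) (k : ℕ) : ℝ := δ ^ (2 / ((N : ℝ) - 2 * s)) * (k : ℝ) ^ (-3 : ℝ)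

/-- The point `r (cos θ, sin θ, 0, …, 0)` of `ℝ^N = ℝ² × ℝ^{N-2}`. -/
def circPt (N : ℕ) (r θ : ℝ) : EuclideanSpace ℝ (Fin N) :=
  (EuclideanSpace.equiv (Fin N) ℝ).symm
    (fun i => if (i : ℕ) = 0 then r * Real.cos θ
      else if (i : ℕ) = 1 then r * Real.sin θ else 0)

/-- The concentration points `ξ_j = √(1-μ²) (cos(2π(j-1)/k), sin(2π(j-1)/k), 0, …, 0)`. -/
def xiPt (N : ℕ) (μ : ℝ) (k j : ℕ) : EuclideanSpace ℝ (Fin N) :=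
  circPt N (Real.sqrt (1 - μ ^ 2)) (2 * Real.pi * ((j : ℝ) - 1) / k)

/-- The ansatz `U_* = U - ∑_{j=1}^k U_j`, where `U_j = w_{μ,ξ_j}`. -/
def Ustar (N : ℕ) (s c δ : ℝ) (k : ℕ) (y : EuclideanSpace ℝ (Fin N)) : ℝ :=
  bubble N s c y -
    ∑ j ∈ Finset.Icc 1 k, wBubble N s c (muK N s δ k) (xiPt N (muK N s δ k) k j) y

/-- The error function `E = U^p - ∑_j U_j^p - |U_*|^{p-1} U_*`. -/
def errFun (N : ℕ) (s c δ : ℝ) (k : ℕ) (y : EuclideanSpace ℝ (Fin N)) : ℝ :=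
  bubble N s c y ^ pExp N s -
    ∑ j ∈ Finset.Icc 1 k,
      wBubble N s c (muK N s δ k) (xiPt N (muK N s δ k) k j) y ^ pExp N s -
    |Ustar N s c δ k y| ^ (pExp N s - 1) * Ustar N s c δ k y

/-- The weighted norm `‖h‖_** = (∫ (1+|y|)^{(N+2s)q-2N} |h|^q)^{1/q}`, valued in `ℝ≥0∞`. -/
def starstarNorm (N : ℕ) (s q : ℝ) (h : EuclideanSpace ℝ (Fin N) → ℝ) : ℝ≥0∞ :=
  (∫⁻ y : EuclideanSpace ℝ (Fin N),
    ENNReal.ofReal ((1 + ‖y‖) ^ (((N : ℝ) + 2 * s) * q - 2 * N) * |h y| ^ q)) ^ (1 / q)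

lemma norm_circPt_sub_sq {N : ℕ} (hN : 2 ≤ N) (r θ φ : ℝ) :
    ‖circPt N r θ - circPt N r φ‖ ^ 2 = (2 * r * Real.sin ((θ - φ) / 2)) ^ 2 := by
  obtain ⟨M, rfl⟩ := Nat.exists_eq_add_of_le' hN
  rw [EuclideanSpace.norm_sq_eq, Fin.sum_univ_succ, Fin.sum_univ_succ]
  have h0 : ∀ i : Fin M, ((i : ℕ) + 1 + 1 = 0) = False := by simp
  simp only [circPt, EuclideanSpace.equiv, PiLp.sub_apply, PiLp.coe_symm_continuousLinearEquiv,
    Fin.val_zero, Fin.val_succ, Real.norm_eq_abs, sq_abs, if_true, zero_add, one_ne_zero,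
    if_false, h0]
  simp only [add_eq_right, Nat.add_eq_zero_iff, one_ne_zero, and_false, if_false, sub_zero]
  have hc := Real.cos_sub_cos θ φ
  have hs := Real.sin_sub_sin θ φ
  have h1 := Real.sin_sq_add_cos_sq ((θ + φ) / 2)
  simp only [← mul_sub, hc, hs]
  simp
  linear_combination (4 * r ^ 2 * Real.sin ((θ - φ) / 2) ^ 2) * h1

lemma norm_circPt {N : ℕ} (hN : 2 ≤ N) {r : ℝ} (hr : 0 ≤ r) (θ : ℝ) : ‖circPt N r θ‖ = r := by
  obtain ⟨M, rfl⟩ := Nat.exists_eq_add_of_le' hN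
  refine (sq_eq_sq₀ (norm_nonneg _) hr).1 ?_
  rw [EuclideanSpace.norm_sq_eq, Fin.sum_univ_succ, Fin.sum_univ_succ]
  simp [circPt, EuclideanSpace.equiv, mul_pow]
  linear_combination r ^ 2 * Real.sin_sq_add_cos_sq θ

/-- Jordan's inequality on `[0, π]`, in terms of the distance to the endpoints. -/
lemma min_le_sin_pi_mul {t : ℝ} (h0 : 0 ≤ t) (h1 : t ≤ 1) :
    2 * min t (1 - t) ≤ Real.sin (π * t) := by
  have hπ := Real.pi_pos
  rcases le_total t (1 / 2) with h | h
  · have := Real.mul_le_sin (x := π * t) (by positivity) (by nlinarith)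
    have e : 2 / π * (π * t) = 2 * t := by field_simp
    linarith [min_le_left t (1 - t)]
  · have := Real.mul_le_sin (x := π * (1 - t)) (mul_nonneg hπ.le (by linarith)) (by nlinarith)
    have e : 2 / π * (π * (1 - t)) = 2 * (1 - t) := by field_simp
    have e2 : π * (1 - t) = π - π * t := by ring
    rw [e, e2, Real.sin_pi_sub] at this
    linarith [min_le_right t (1 - t)]

lemma min_le_norm_xiPt_sub {N : ℕ} (hN : 2 ≤ N) {μ : ℝ} (hr : 1 / 2 ≤ √(1 - μ ^ 2)) {k i j : ℕ}
    (hij : i ≤ j) (hjk : j - i ≤ k) (hk : 0 < k) :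
    2 * min ((j : ℝ) - i) (k - ((j : ℝ) - i)) ≤ k * ‖xiPt N μ k j - xiPt N μ k i‖ := by
  have hk' : (0 : ℝ) < k := by exact_mod_cast hk
  have hij' : (i : ℝ) ≤ j := by exact_mod_cast hij
  have hjk' : (j : ℝ) - i ≤ k := by
    rw [← Nat.cast_sub hij]; exact_mod_cast hjk
  have hs := min_le_sin_pi_mul (t := ((j : ℝ) - i) / k)
    (div_nonneg (by linarith) hk'.le) ((div_le_one hk').2 hjk')
  have hmin : min ((j : ℝ) - i) (k - ((j : ℝ) - i)) =
      k * min (((j : ℝ) - i) / k) (1 - ((j : ℝ) - i) / k) := by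
    rw [mul_min_of_nonneg _ _ hk'.le]
    congr 1 <;> field_simp
  have hm0 : 0 ≤ min (((j : ℝ) - i) / k) (1 - ((j : ℝ) - i) / k) :=
    le_min (div_nonneg (by linarith) hk'.le) (by rw [sub_nonneg, div_le_one hk']; exact hjk')
  have hn := norm_circPt_sub_sq hN (√(1 - μ ^ 2))
    (2 * π * ((j : ℝ) - 1) / k) (2 * π * ((i : ℝ) - 1) / k)
  have e : (2 * π * ((j : ℝ) - 1) / k - 2 * π * ((i : ℝ) - 1) / k) / 2 =
      π * (((j : ℝ) - i) / k) := by ring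
  rw [e] at hn
  have hs0 : 0 ≤ Real.sin (π * (((j : ℝ) - i) / k)) := by linarith
  have hn' := (sq_eq_sq₀ (norm_nonneg _) (by positivity)).1 hn
  rw [xiPt, xiPt, hn', hmin]
  have : 2 * min (((j : ℝ) - i) / k) (1 - ((j : ℝ) - i) / k) ≤
      2 * √(1 - μ ^ 2) * Real.sin (π * (((j : ℝ) - i) / k)) := by nlinarith
  nlinarith

/-- A family of points which is at distance at least `η` from `0` and at least as spread out as
`min n (k - n)` on the cyclic index set has a bounded sum of negative powers. -/
lemma sum_rpow_neg_le_of_cyclic_spacing {b : ℝ} (hb : 1 < b) {η : ℝ} (hη : 0 < η) {k : ℕ}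
    {x : ℕ → ℝ} (hx : ∀ j ∈ Finset.Icc 1 k, η ≤ x j) {i : ℕ} (hi : i ∈ Finset.Icc 1 k)
    (hmin : ∀ j ∈ Finset.Icc 1 k,
      min |(j : ℝ) - i| (k - |(j : ℝ) - i|) ≤ x j) :
    ∑ j ∈ Finset.Icc 1 k, x j ^ (-b) ≤ η ^ (-b) + 3 * ∑' n : ℤ, |(n : ℝ)| ^ (-b) := by
  set g : ℤ → ℝ := fun n => |(n : ℝ)| ^ (-b) with hg
  have hsum : Summable g := Real.summable_abs_int_rpow hb
  have hg0 : ∀ n, 0 ≤ g n := fun n => by positivity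
  have hshift : ∀ m : ℤ, ∑ j ∈ Finset.Icc 1 k, g ((j : ℤ) - m) ≤ ∑' n, g n := by
    intro m
    have hinj : Function.Injective fun j : ℕ => (j : ℤ) - m := fun a b h => by
      simp only at h; omega
    have := hsum.sum_le_tsum ((Finset.Icc 1 k).map ⟨_, hinj⟩) fun n _ => hg0 n
    simpa using this
  have hterm : ∀ j ∈ Finset.Icc 1 k, x j ^ (-b) ≤ (if j = i then η ^ (-b) else 0) +
      (g ((j : ℤ) - i) + g ((j : ℤ) - (i + k)) + g ((j : ℤ) - (i - k))) := by
    intro j hj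
    have h1 := hg0 ((j : ℤ) - i)
    have h2 := hg0 ((j : ℤ) - (i + k))
    have h3 := hg0 ((j : ℤ) - (i - k))
    have hb' : -b ≤ 0 := by linarith
    by_cases hji : j = i
    · have := Real.rpow_le_rpow_of_nonpos hη (hx j hj) hb'
      rw [if_pos hji]
      linarith
    · rw [if_neg hji, zero_add]
      have hcmp : ∀ n : ℤ, n ≠ 0 → |(n : ℝ)| ≤ x j → x j ^ (-b) ≤ g n := fun n hn h =>
        Real.rpow_le_rpow_of_nonpos (abs_pos.2 (by exact_mod_cast hn)) h hb'
      have hm := hmin j hj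
      rw [Finset.mem_Icc] at hi hj
      have hjR : (1 : ℝ) ≤ j ∧ (j : ℝ) ≤ k := by exact_mod_cast hj
      have hiR : (1 : ℝ) ≤ i ∧ (i : ℝ) ≤ k := by exact_mod_cast hi
      rcases min_le_iff.1 hm with h | h
      · have := hcmp ((j : ℤ) - i) (by omega) (by push_cast; exact h)
        linarith
      · rcases le_total (i : ℝ) j with hle | hle
        · rw [abs_of_nonneg (by linarith)] at h
          have := hcmp ((j : ℤ) - (i + k)) (by omega)
            (by push_cast; rw [abs_of_nonpos (by linarith)]; linarith)
          linarith
        · rw [abs_of_nonpos (by linarith)] at h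
          have := hcmp ((j : ℤ) - (i - k)) (by omega)
            (by push_cast; rw [abs_of_nonneg (by linarith)]; linarith)
          linarith
  refine (Finset.sum_le_sum hterm).trans ?_
  simp only [Finset.sum_add_distrib, Finset.sum_ite_eq', if_pos hi]
  linarith [hshift i, hshift (i + k), hshift (i - k)]

/-- The rescaled bubble is dominated by its singular profile. -/
lemma wBubble_le {N : ℕ} {s c μ : ℝ} (hN : 0 ≤ (N : ℝ) - 2 * s) (hc : 0 ≤ c) (hμ : 0 < μ)
    {ξ y : EuclideanSpace ℝ (Fin N)} (hy : 0 < ‖y - ξ‖) :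
    wBubble N s c μ ξ y ≤
      c * μ ^ (((N : ℝ) - 2 * s) / 2) * ‖y - ξ‖ ^ (-((N : ℝ) - 2 * s)) := by
  set a := ((N : ℝ) - 2 * s) / 2 with ha
  have ha0 : 0 ≤ a := by positivity
  have e2 : -((N : ℝ) - 2 * s) = 2 * (-a) := by rw [ha]; ring
  have h1 : (1 / (1 + ‖μ⁻¹ • (y - ξ)‖ ^ 2)) ^ a ≤ (μ ^ 2 / ‖y - ξ‖ ^ 2) ^ a := by
    refine Real.rpow_le_rpow (by positivity) ?_ ha0
    rw [norm_smul, Real.norm_of_nonneg (inv_nonneg.2 hμ.le), div_le_div_iff₀ (by positivity)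
      (by positivity)]
    have : μ ^ 2 * (1 + (μ⁻¹ * ‖y - ξ‖) ^ 2) = μ ^ 2 + ‖y - ξ‖ ^ 2 := by field_simp
    rw [this]
    nlinarith [sq_nonneg μ]
  have h2 : (μ ^ 2 / ‖y - ξ‖ ^ 2) ^ a = μ ^ a * μ ^ a * ‖y - ξ‖ ^ (2 * (-a)) := by
    rw [Real.div_rpow (by positivity) (by positivity), Real.rpow_mul hy.le,
      Real.rpow_neg (by positivity), sq μ, Real.mul_rpow hμ.le hμ.le, div_eq_mul_inv]
    norm_cast
  have h3 : μ ^ (-a) * μ ^ a = 1 := by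
    rw [← Real.rpow_add hμ]; simp
  rw [e2, wBubble, bubble, ← ha]
  calc μ ^ (-a) * (c * (1 / (1 + ‖μ⁻¹ • (y - ξ)‖ ^ 2)) ^ a)
      ≤ μ ^ (-a) * (c * (μ ^ a * μ ^ a * ‖y - ξ‖ ^ (2 * (-a)))) := by
        rw [← h2]; gcongr
    _ = c * μ ^ a * ‖y - ξ‖ ^ (2 * (-a)) := by
        linear_combination (c * μ ^ a * ‖y - ξ‖ ^ (2 * (-a))) * h3

lemma muK_rpow {N : ℕ} {s δ : ℝ} (hN : 0 < (N : ℝ) - 2 * s) (hδ : 0 ≤ δ) (k : ℕ) :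
    muK N s δ k ^ (((N : ℝ) - 2 * s) / 2) = δ * (k : ℝ) ^ (-3 * (((N : ℝ) - 2 * s) / 2)) := by
  rw [muK, Real.mul_rpow (by positivity) (by positivity), ← Real.rpow_mul hδ,
    ← Real.rpow_mul (by positivity)]
  congr 1
  rw [show 2 / ((N : ℝ) - 2 * s) * (((N : ℝ) - 2 * s) / 2) = 1 by field_simp, Real.rpow_one]

lemma muK_pos {N : ℕ} {s δ : ℝ} (hδ : 0 < δ) {k : ℕ} (hk : 0 < k) : 0 < muK N s δ k := by
  have : (0 : ℝ) < k := by exact_mod_cast hk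
  rw [muK]; positivity

lemma muK_le_half {N : ℕ} {s δ : ℝ} (hδ : 0 < δ) {k : ℕ} (hk : 0 < k)
    (h : 2 * δ ^ (2 / ((N : ℝ) - 2 * s)) ≤ k) : muK N s δ k ≤ 1 / 2 := by
  have hk1 : (1 : ℝ) ≤ k := by exact_mod_cast hk
  have h3 : (k : ℝ) ^ (-3 : ℝ) ≤ (k : ℝ)⁻¹ := by
    rw [← Real.rpow_neg_one]
    exact Real.rpow_le_rpow_of_exponent_le hk1 (by norm_num)
  have hD : 0 < δ ^ (2 / ((N : ℝ) - 2 * s)) := by positivity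
  calc muK N s δ k ≤ δ ^ (2 / ((N : ℝ) - 2 * s)) * (k : ℝ)⁻¹ := by rw [muK]; gcongr
    _ ≤ 1 / 2 := by
      rw [← div_eq_mul_inv, div_le_iff₀ (by linarith)]; linarith

lemma sum_norm_sub_xiPt_rpow_neg_le {N : ℕ} (hN : 2 ≤ N) {b : ℝ} (hb : 1 < b) {η : ℝ} (hη : 0 < η)
    {μ : ℝ} (hr : 1 / 2 ≤ √(1 - μ ^ 2)) {k : ℕ} (hk : 0 < k) {y : EuclideanSpace ℝ (Fin N)}
    (hy : ∀ j ∈ Finset.Icc 1 k, η / k < ‖y - xiPt N μ k j‖) :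
    ∑ j ∈ Finset.Icc 1 k, ‖y - xiPt N μ k j‖ ^ (-b) ≤
      (k : ℝ) ^ b * (η ^ (-b) + 3 * ∑' n : ℤ, |(n : ℝ)| ^ (-b)) := by
  have hk' : (0 : ℝ) < k := by exact_mod_cast hk
  obtain ⟨i, hi, hmin⟩ := Finset.exists_min_image (Finset.Icc 1 k)
    (fun j => ‖y - xiPt N μ k j‖) ⟨1, Finset.mem_Icc.2 ⟨le_rfl, hk⟩⟩
  have key := sum_rpow_neg_le_of_cyclic_spacing hb hη (k := k)
    (x := fun j => k * ‖y - xiPt N μ k j‖)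
    (fun j hj => by
      have := hy j hj
      rw [div_lt_iff₀ hk'] at this
      linarith) hi
    (fun j hj => by
      have htri : ‖xiPt N μ k j - xiPt N μ k i‖ ≤ 2 * ‖y - xiPt N μ k j‖ := by
        have h1 := norm_sub_le (y - xiPt N μ k i) (y - xiPt N μ k j)
        rw [_root_.sub_sub_sub_cancel_left] at h1
        have h2 := hmin j hj
        linarith
      have hchord : 2 * min |(j : ℝ) - i| (k - |(j : ℝ) - i|) ≤
          k * ‖xiPt N μ k j - xiPt N μ k i‖ := by
        rw [Finset.mem_Icc] at hi hj
        rcases le_total i j with h | h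
        · rw [abs_of_nonneg (by rw [sub_nonneg]; exact_mod_cast h)]
          exact min_le_norm_xiPt_sub hN hr h (by omega) hk
        · rw [abs_sub_comm, abs_of_nonneg (by rw [sub_nonneg]; exact_mod_cast h), norm_sub_rev]
          exact min_le_norm_xiPt_sub hN hr h (by omega) hk
      nlinarith)
  have hsplit : ∀ j ∈ Finset.Icc 1 k, ‖y - xiPt N μ k j‖ ^ (-b) =
      (k : ℝ) ^ b * (k * ‖y - xiPt N μ k j‖) ^ (-b) := by
    intro j _
    rw [Real.mul_rpow hk'.le (norm_nonneg _), ← mul_assoc, ← Real.rpow_add hk']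
    simp
  rw [Finset.sum_congr rfl hsplit, ← Finset.mul_sum]
  gcongr

/-- In the exterior region, the sum of the bubbles `U_j` is dominated by `U`:
`∑_{j=1}^k U_j(y) ≤ C U(y)`. -/
theorem sum_bubbles_le_bubble_exterior
    (N : ℕ) (hN : 3 ≤ N) (s : ℝ) (hs : s ∈ Set.Ioo (0 : ℝ) 1) (c : ℝ) (hc : 0 < c)
    (δ : ℝ) (hδ : 0 < δ) (η : ℝ) (hη : η ∈ Set.Ioo (0 : ℝ) 1) :
    ∃ k₀ : ℕ, 2 ≤ k₀ ∧ ∃ C : ℝ, 0 < C ∧ ∀ k : ℕ, k₀ ≤ k →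
      ∀ y : EuclideanSpace ℝ (Fin N),
        (∀ j ∈ Finset.Icc 1 k, η / k < ‖y - xiPt N (muK N s δ k) k j‖) →
        ∑ j ∈ Finset.Icc 1 k, wBubble N s c (muK N s δ k) (xiPt N (muK N s δ k) k j) y ≤
          C * bubble N s c y := by
  have hs1 := hs.2
  have hη0 := hη.1
  have hN' : (3 : ℝ) ≤ N := by exact_mod_cast hN
  have hN2 : 2 ≤ N := by omega
  set a := ((N : ℝ) - 2 * s) / 2 with ha
  have hb : (N : ℝ) - 2 * s = 2 * a := by rw [ha]; ring
  have ha1 : 1 < 2 * a := by rw [← hb]; linarith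
  have hpos : 0 < (N : ℝ) - 2 * s := by linarith
  have hT : 0 ≤ ∑' n : ℤ, |(n : ℝ)| ^ (-(2 * a)) := tsum_nonneg fun n => by positivity
  obtain ⟨m, hm⟩ := exists_nat_ge (2 * δ ^ (2 / ((N : ℝ) - 2 * s)))
  refine ⟨max 2 m, le_max_left _ _,
    δ * (η ^ (-(2 * a)) + 3 * ∑' n : ℤ, |(n : ℝ)| ^ (-(2 * a))) * 5 ^ a + δ * 8 ^ a,
    by positivity, fun k hk y hy => ?_⟩
  have hk2 : 2 ≤ k := (le_max_left _ _).trans hk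
  have hk0 : 0 < k := by omega
  have hk1 : (1 : ℝ) ≤ k := by exact_mod_cast hk0
  have hkm : (m : ℝ) ≤ k := by exact_mod_cast (le_max_right _ _).trans hk
  have hk' : (0 : ℝ) < k := by linarith
  have hμ := muK_pos (N := N) (s := s) hδ hk0
  have hμ2 := muK_le_half (N := N) (s := s) hδ hk0 (hm.trans hkm)
  have hμa := muK_rpow hpos hδ.le k
  set μ := muK N s δ k
  have hr : 1 / 2 ≤ √(1 - μ ^ 2) := Real.le_sqrt_of_sq_le (by nlinarith)
  have hr1 : √(1 - μ ^ 2) ≤ 1 := Real.sqrt_le_one.2 (by nlinarith)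
  have hypos : ∀ j ∈ Finset.Icc 1 k, 0 < ‖y - xiPt N μ k j‖ := fun j hj =>
    (by positivity : 0 < η / k).trans (hy j hj)
  rw [← ha] at hμa
  have hsum : ∑ j ∈ Finset.Icc 1 k, wBubble N s c μ (xiPt N μ k j) y ≤
      c * (δ * (k : ℝ) ^ (-3 * a)) * ∑ j ∈ Finset.Icc 1 k, ‖y - xiPt N μ k j‖ ^ (-(2 * a)) := by
    rw [Finset.mul_sum]
    refine Finset.sum_le_sum fun j hj => ?_
    have := wBubble_le hpos.le hc.le hμ (hypos j hj)
    rwa [← ha, hμa, hb] at this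
  refine hsum.trans ?_
  rw [bubble, ← ha]
  have hU : 0 ≤ (1 / (1 + ‖y‖ ^ 2)) ^ a := by positivity
  set A := η ^ (-(2 * a)) + 3 * ∑' n : ℤ, |(n : ℝ)| ^ (-(2 * a)) with hA
  have hA0 : 0 ≤ A := by positivity
  rcases le_total ‖y‖ 2 with h2 | h2
  · have hs2 := sum_norm_sub_xiPt_rpow_neg_le hN2 ha1 hη0 hr hk0 hy
    have hkk : (k : ℝ) ^ (-3 * a) * (k : ℝ) ^ (2 * a) ≤ 1 := by
      rw [← Real.rpow_add hk']
      exact Real.rpow_le_one_of_one_le_of_nonpos hk1 (by linarith)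
    have h5 : 1 ≤ (5 : ℝ) ^ a * (1 / (1 + ‖y‖ ^ 2)) ^ a := by
      rw [← Real.mul_rpow (by norm_num) (by positivity)]
      refine Real.one_le_rpow ?_ (by linarith)
      rw [mul_one_div, one_le_div (by positivity)]
      nlinarith [norm_nonneg y]
    calc _ ≤ c * (δ * (k : ℝ) ^ (-3 * a)) * ((k : ℝ) ^ (2 * a) * A) := by gcongr
      _ = c * δ * A * ((k : ℝ) ^ (-3 * a) * (k : ℝ) ^ (2 * a)) := by ring
      _ ≤ c * δ * A * 1 := by gcongr
      _ ≤ c * δ * A * ((5 : ℝ) ^ a * (1 / (1 + ‖y‖ ^ 2)) ^ a) := by gcongr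
      _ ≤ c * δ * A * ((5 : ℝ) ^ a * (1 / (1 + ‖y‖ ^ 2)) ^ a) +
          δ * 8 ^ a * (c * (1 / (1 + ‖y‖ ^ 2)) ^ a) := le_add_of_nonneg_right (by positivity)
      _ = _ := by ring
  · have hterm : ∀ j ∈ Finset.Icc 1 k,
        ‖y - xiPt N μ k j‖ ^ (-(2 * a)) ≤ 8 ^ a * (1 / (1 + ‖y‖ ^ 2)) ^ a := by
      intro j hj
      have h1 := norm_sub_norm_le y (xiPt N μ k j)
      rw [xiPt, norm_circPt hN2 (by linarith), ← xiPt] at h1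
      rw [← Real.mul_rpow (by norm_num) (by positivity), ← mul_neg,
        Real.rpow_mul (norm_nonneg _), Real.rpow_neg (by positivity),
        ← Real.inv_rpow (by positivity)]
      refine Real.rpow_le_rpow (by positivity) ?_ (by linarith)
      have hp := hypos j hj
      rw [Real.rpow_two, mul_one_div, inv_eq_one_div, div_le_div_iff₀ (by positivity)
        (by positivity)]
      nlinarith
    have hs2 := Finset.sum_le_sum hterm
    rw [Finset.sum_const, Nat.card_Icc, nsmul_eq_mul, Nat.add_sub_cancel] at hs2
    have hkk : (k : ℝ) ^ (-3 * a) * k ≤ 1 := by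
      nth_rewrite 2 [← Real.rpow_one (k : ℝ)]
      rw [← Real.rpow_add hk']
      exact Real.rpow_le_one_of_one_le_of_nonpos hk1 (by linarith)
    calc _ ≤ c * (δ * (k : ℝ) ^ (-3 * a)) * (k * (8 ^ a * (1 / (1 + ‖y‖ ^ 2)) ^ a)) := by gcongr
      _ = c * δ * (8 ^ a * (1 / (1 + ‖y‖ ^ 2)) ^ a) * ((k : ℝ) ^ (-3 * a) * k) := by ring
      _ ≤ c * δ * (8 ^ a * (1 / (1 + ‖y‖ ^ 2)) ^ a) * 1 := by gcongr
      _ ≤ c * δ * (8 ^ a * (1 / (1 + ‖y‖ ^ 2)) ^ a) * 1 +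
          δ * A * 5 ^ a * (c * (1 / (1 + ‖y‖ ^ 2)) ^ a) := le_add_of_nonneg_right (by positivity)
      _ = _ := by ring

end
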